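/- Let n ∈ ℤ_+, B ≥ 1 and d ∈ ℤ_+. For each t > 0 let K_t ∈ ℓ¹(ℤ^d) with ‖K_t‖_{ℓ¹(ℤ^d)} ≤ B, and let m_t(ξ) := Σ_{k∈ℤ^d} K_t(k) e^{2πi k·ξ} for ξ ∈ 𝕋^d. Assume that for each ξ ∈ 𝕋^d the map t ↦ m_t(ξ) is smooth on (0,∞) and that |s^j ∂_s^j m_s(ξ)| ≤ B for all 0 ≤ j ≤ n, all s > 0 and all ξ ∈ 𝕋^d. Let 1 < p ≤ 2 and let q be the dual exponent (1/p + 1/q = 1), and suppose 2n/q ≤ 1. Then for every α ∈ (0, 2n/q) there exists a constant C(n,p,α) > 0, depending only on n, p and α (and in particular independent of d and of the family (K_t)), such that for all w, t > 0 and all f ∈ ℓ^p(ℤ^d) one has ‖ (K_{t+w} − K_t) * f ‖_{ℓ^p(ℤ^d)} ≤ C(n,p,α) · B · (w/t)^α · ‖f‖_{ℓ^p(ℤ^d)}. -/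

import Mathlib

open scoped ENNReal Real BigOperators
open Real

/-- The one-dimensional Theta function `θ_t(ζ) = Σ_{k∈ℤ} exp(-π(k-ζ)²t)`. -/
noncomputable def theta (t ζ : ℝ) : ℝ :=
  ∑' k : ℤ, Real.exp (-π * ((k : ℝ) - ζ) ^ 2 * t)

/-- The d-dimensional Theta function `Θ_t(ξ) = Π_j θ_t(ξ_j)`. -/
noncomputable def bigTheta (d : ℕ) (t : ℝ) (ξ : Fin d → ℝ) : ℝ :=
  ∏ j, theta t (ξ j)

/-- The discrete normalized Gaussian kernel `g_t(n) = Θ_{1/t}(0)⁻¹ exp(-π|n|²/t)`. -/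
noncomputable def gauss (d : ℕ) (t : ℝ) (n : Fin d → ℤ) : ℝ :=
  (bigTheta d (1 / t) 0)⁻¹ * Real.exp (-π * (∑ j, ((n j : ℝ)) ^ 2) / t)

/-- The convolution operator `G_t f(x) = Σ_n g_t(n) f(x-n)` on ℤ^d. -/
noncomputable def gConv (d : ℕ) (t : ℝ) (f : (Fin d → ℤ) → ℂ) (x : Fin d → ℤ) : ℂ :=
  ∑' n : Fin d → ℤ, (gauss d t n : ℂ) * f (x - n)

/-- The ℓ^p norm (valued in ℝ≥0∞) of an ℝ≥0∞-valued function on ℤ^d. -/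
noncomputable def lpNorm (d : ℕ) (p : ℝ) (F : (Fin d → ℤ) → ℝ≥0∞) : ℝ≥0∞ :=
  (∑' x : Fin d → ℤ, F x ^ p) ^ (1 / p)

/-- The Fourier multiplier `m_t(ξ) = Σ_{k∈ℤ^d} K_t(k) e^{2πi k·ξ}` of an ℓ¹ kernel `K_t`. -/
noncomputable def mult (d : ℕ) (K : ℝ → (Fin d → ℤ) → ℂ) (t : ℝ) (ξ : Fin d → ℝ) : ℂ :=
  ∑' k : Fin d → ℤ, K t k *
    Complex.exp (2 * (π : ℂ) * Complex.I * ∑ j, (k j : ℂ) * (ξ j : ℂ))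


/-! ### Marchaud -/

lemma fd_comm {X : Type*} [AddCommGroup X] (F : ℝ → X) (h : ℝ) (k : ℕ) (s : ℝ) :
    (fwdDiff h)^[k] (fwdDiff (2 * h) F) s
      = (fwdDiff h)^[k + 1] F (s + h) + (fwdDiff h)^[k + 1] F s := by
  have h1 : fwdDiff (2 * h) F = (fun x => fwdDiff h F (x + h)) + fwdDiff h F := by
    funext x
    simp only [fwdDiff, Pi.add_apply]
    rw [show x + h + h = x + 2 * h by ring]
    abel
  rw [h1, fwdDiff_iter_add, Pi.add_apply, fwdDiff_iter_comp_add]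
  simp only [Function.iterate_succ_apply]

lemma marchaud_id (k : ℕ) :
    ∃ D : ℝ, 0 ≤ D ∧ ∀ (X : Type) [NormedAddCommGroup X] [NormedSpace ℝ X] (F : ℝ → X) (h t ε : ℝ), 0 < h →
      (∀ s, t ≤ s → ‖(fwdDiff h)^[k + 1] F s‖ ≤ ε) →
      ∀ s, t ≤ s → ‖(fwdDiff (2 * h))^[k] F s - (2 : ℝ) ^ k • (fwdDiff h)^[k] F s‖ ≤ D * ε := by
  induction k with
  | zero => exact ⟨0, le_rfl, fun X _ _ F h t ε hh H s hs => by simp⟩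
  | succ k ih =>
    obtain ⟨D, hD, H⟩ := ih
    refine ⟨2 * D + 2 ^ k, by positivity, fun X _ _ F h t ε hh hF s hs => ?_⟩
    have e1 := H X (fwdDiff (2 * h) F) h t (2 * ε) hh (fun s hs => by
      rw [fd_comm]
      refine (norm_add_le _ _).trans ?_
      have a1 := hF (s + h) (by linarith)
      have a2 := hF s hs
      linarith) s hs
    have e2 : (fwdDiff (2 * h))^[k + 1] F s - (2 : ℝ) ^ (k + 1) • (fwdDiff h)^[k + 1] F s
        = ((fwdDiff (2 * h))^[k] (fwdDiff (2 * h) F) s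
            - (2 : ℝ) ^ k • (fwdDiff h)^[k] (fwdDiff (2 * h) F) s)
          + (2 : ℝ) ^ k • (fwdDiff h)^[k + 1 + 1] F s := by
      rw [fd_comm, Function.iterate_succ_apply' (fwdDiff h) (k + 1),
        Function.iterate_succ_apply (fwdDiff (2 * h)) k]
      simp only [fwdDiff, pow_succ]
      module
    rw [e2]
    refine (norm_add_le _ _).trans ?_
    rw [norm_smul, norm_pow, Real.norm_ofNat]
    have := mul_le_mul_of_nonneg_left (hF s hs) (show (0 : ℝ) ≤ 2 ^ k by positivity)
    linarith

lemma fd_bound {X : Type*} [NormedAddCommGroup X] (F : ℝ → X) (h t M : ℝ) (hh : 0 < h)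
    (hF : ∀ s, t ≤ s → ‖F s‖ ≤ M) (k : ℕ) :
    ∀ s, t ≤ s → ‖(fwdDiff h)^[k] F s‖ ≤ 2 ^ k * M := by
  induction k with
  | zero => simpa using hF
  | succ k ih =>
    intro s hs
    rw [Function.iterate_succ_apply', fwdDiff]
    refine (norm_sub_le _ _).trans ?_
    have a1 := ih (s + h) (by linarith)
    have a2 := ih s hs
    rw [pow_succ]; linarith

lemma marchaud_step (k : ℕ) (hk : 1 ≤ k)
    (α : ℝ) (hα : α < 1) :
    ∃ c : ℝ, 0 ≤ c ∧ ∀ (X : Type) [NormedAddCommGroup X] [NormedSpace ℝ X]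
      (F : ℝ → X) (t A M : ℝ), 0 ≤ A → 0 ≤ M →
      (∀ s, t ≤ s → ‖F s‖ ≤ M) →
      (∀ h, 0 < h → ∀ s, t ≤ s → ‖(fwdDiff h)^[k + 1] F s‖ ≤ A * h ^ α) →
      ∀ h, 0 < h → ∀ s, t ≤ s → ‖(fwdDiff h)^[k] F s‖ ≤ c * A * h ^ α := by
  obtain ⟨D, hD, H⟩ := marchaud_id k
  have h2 : (2 : ℝ) ^ α < 2 := by
    simpa using Real.rpow_lt_rpow_of_exponent_lt (show (1 : ℝ) < 2 by norm_num) hα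
  have hc0 : 0 ≤ D / (2 - 2 ^ α) := div_nonneg hD (by linarith)
  have hc1 : D / (2 - 2 ^ α) * 2 ^ α + D = 2 * (D / (2 - 2 ^ α)) := by
    have : (2 - (2 : ℝ) ^ α) ≠ 0 := by linarith
    field_simp
    ring
  set c := D / (2 - 2 ^ α) with hc
  refine ⟨c, hc0, fun X _ _ F t A M hA hM hF hd => ?_⟩
  have key : ∀ J : ℕ, ∀ h, 0 < h → ∀ s, t ≤ s →
      ‖(fwdDiff h)^[k] F s‖ ≤ (1 / 2) ^ J * (2 ^ k * M) + c * A * h ^ α := by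
    intro J
    induction J with
    | zero =>
      intro h hh s hs
      have := fd_bound F h t M hh hF k s hs
      have : 0 ≤ c * A * h ^ α := by positivity
      simp; linarith
    | succ J ih =>
      intro h hh s hs
      have e1 := H X F h t _ hh (hd h hh) s hs
      have e2 := ih (2 * h) (by linarith) s hs
      have e3 : ‖(2 : ℝ) ^ k • (fwdDiff h)^[k] F s‖ ≤
          ‖(fwdDiff (2 * h))^[k] F s‖ +
          ‖(fwdDiff (2 * h))^[k] F s - (2 : ℝ) ^ k • (fwdDiff h)^[k] F s‖ := by
        rw [norm_sub_rev, add_comm]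
        have := norm_sub_le ((2 : ℝ) ^ k • (fwdDiff h)^[k] F s) ((fwdDiff (2 * h))^[k] F s)
        exact norm_le_norm_sub_add _ _
      rw [norm_smul, norm_pow, Real.norm_ofNat] at e3
      rw [Real.mul_rpow (by norm_num) hh.le] at e2
      have e4 : (2 : ℝ) * ‖(fwdDiff h)^[k] F s‖ ≤ 2 ^ k * ‖(fwdDiff h)^[k] F s‖ := by
        gcongr
        exact le_self_pow₀ (by norm_num) (by omega)
      have e5 : c * A * (2 ^ α * h ^ α) + D * (A * h ^ α) = 2 * (c * A * h ^ α) := by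
        linear_combination (A * h ^ α) * hc1
      rw [pow_succ]
      linarith
  intro h hh s hs
  have lim : Filter.Tendsto (fun J : ℕ => (1 / 2 : ℝ) ^ J * (2 ^ k * M) + c * A * h ^ α)
      Filter.atTop (nhds (0 * (2 ^ k * M) + c * A * h ^ α)) := by
    refine Filter.Tendsto.add_const _ (Filter.Tendsto.mul_const _ ?_)
    exact tendsto_pow_atTop_nhds_zero_of_lt_one (by norm_num) (by norm_num)
  have := ge_of_tendsto' lim (fun J => key J h hh s hs)
  linarith

lemma marchaud (n : ℕ)
    (α : ℝ) (hα : α < 1) :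
    ∃ c : ℝ, 0 ≤ c ∧ ∀ (X : Type) [NormedAddCommGroup X] [NormedSpace ℝ X]
      (F : ℝ → X) (t A M : ℝ), 0 ≤ A → 0 ≤ M →
      (∀ s, t ≤ s → ‖F s‖ ≤ M) →
      (∀ h, 0 < h → ∀ s, t ≤ s → ‖(fwdDiff h)^[n + 1] F s‖ ≤ A * h ^ α) →
      ∀ h, 0 < h → ∀ s, t ≤ s → ‖F (s + h) - F s‖ ≤ c * A * h ^ α := by
  induction n with
  | zero => exact ⟨1, zero_le_one, fun X _ _ F t A M hA hM hF hd h hh s hs => by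
      simpa [fwdDiff] using hd h hh s hs⟩
  | succ n ih =>
    obtain ⟨c, hc, H⟩ := ih
    obtain ⟨c', hc', H'⟩ := marchaud_step (n + 1) (by omega) α hα
    refine ⟨c * c', by positivity, fun X _ _ F t A M hA hM hF hd h hh s hs => ?_⟩
    have := H X F t (c' * A) M (by positivity) hM hF (H' X F t A M hA hM hF hd) h hh s hs
    linarith

/-! ### finite differences of smooth functions -/


lemma fd_deriv (g : ℝ → ℂ) (h : ℝ) (hh : 0 < h) (hg : ∀ s, 0 < s → DifferentiableAt ℝ g s) (n : ℕ) :
    ∀ s, 0 < s → HasDerivAt ((fwdDiff h)^[n] g) ((fwdDiff h)^[n] (deriv g) s) s := by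
  induction n with
  | zero => exact fun s hs => (hg s hs).hasDerivAt
  | succ n ih =>
    intro s hs
    rw [Function.iterate_succ_apply', Function.iterate_succ_apply']
    exact (HasDerivAt.comp_add_const s h (ih (s + h) (by linarith))).sub (ih s hs)

lemma fd_smooth (n : ℕ) : ∀ (g : ℝ → ℂ) (t M : ℝ), 0 < t →
    ContDiffOn ℝ (⊤ : ℕ∞) g (Set.Ioi 0) →
    (∀ s, t ≤ s → ‖iteratedDeriv n g s‖ ≤ M) → ∀ h, 0 < h →
    ∀ s, t ≤ s → ‖(fwdDiff h)^[n] g s‖ ≤ h ^ n * M := by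
  induction n with
  | zero => intro g t M ht hg H h hh s hs; simpa using H s hs
  | succ n ih =>
    intro g t M ht hg H h hh s hs
    have hg' : ContDiffOn ℝ (⊤ : ℕ∞) (deriv g) (Set.Ioi 0) :=
      hg.deriv_of_isOpen isOpen_Ioi (by simp)
    have hd : ∀ s, 0 < s → DifferentiableAt ℝ g s := fun s hs =>
      (hg.differentiableOn (by simp)).differentiableAt (Ioi_mem_nhds hs)
    have b := ih (deriv g) t M ht hg' (fun s hs => by
      rw [← iteratedDeriv_succ']; exact H s hs) h hh
    have := Convex.norm_image_sub_le_of_norm_hasDerivWithin_le (s := Set.Ici t)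
      (f := (fwdDiff h)^[n] g) (f' := (fwdDiff h)^[n] (deriv g)) (C := h ^ n * M)
      (x := s) (y := s + h)
      (fun x hx => (fd_deriv g h hh hd n x (lt_of_lt_of_le ht hx)).hasDerivWithinAt)
      (fun x hx => b x hx) (convex_Ici t) hs (show t ≤ s + h by linarith)
    rw [Function.iterate_succ_apply', fwdDiff]
    refine this.trans (le_of_eq ?_)
    rw [add_sub_cancel_left, Real.norm_of_nonneg hh.le]
    ring

/-! ### Riesz-Thorin for finite matrices -/

lemma diff_term (c : ℝ) (e : ℂ → ℂ) (he : Differentiable ℂ e) (hc : 0 < c) :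
    Differentiable ℂ (fun z => (c : ℂ) ^ (e z)) := by
  intro z
  exact (he z).const_cpow (Or.inl (by exact_mod_cast hc.ne'))

/-- analytic family `|u|^{e} sgn u` -/
noncomputable def anF (u : ℂ) (e : ℂ) : ℂ := (if u = 0 then 0 else u / ‖u‖ * ((‖u‖ : ℝ) : ℂ) ^ e)

lemma anF_one (u : ℂ) : anF u 1 = u := by
  unfold anF
  split_ifs with h
  · exact h.symm
  · have : ((‖u‖ : ℝ) : ℂ) ≠ 0 := by simpa using h
    rw [Complex.cpow_one]; field_simp

lemma anF_norm (u : ℂ) (e : ℂ) (he : e.re ≠ 0) : ‖anF u e‖ = ‖u‖ ^ e.re := by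
  unfold anF
  split_ifs with h
  · simp [h, he]
  · have : 0 < ‖u‖ := by simpa using h
    rw [norm_mul, Complex.norm_cpow_eq_rpow_re_of_pos this]
    simp [this.ne']

lemma anF_norm_le (u : ℂ) (e : ℂ) : ‖anF u e‖ ≤ ‖u‖ ^ e.re := by
  unfold anF
  split_ifs with h
  · simp; positivity
  · have : 0 < ‖u‖ := by simpa using h
    rw [norm_mul, Complex.norm_cpow_eq_rpow_re_of_pos this]
    simp [this.ne']

lemma anF_diff (u : ℂ) (e : ℂ → ℂ) (he : Differentiable ℂ e) :
    Differentiable ℂ (fun z => anF u (e z)) := by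
  unfold anF
  split_ifs with h
  · fun_prop
  · exact (diff_term _ e he (by simpa using h)).const_mul _

lemma rpow_le_max (x r a : ℝ) (hx : 0 ≤ x) (hr0 : 0 ≤ r) (hra : r ≤ a) : x ^ r ≤ max 1 x ^ a :=
  (Real.rpow_le_rpow hx (le_max_right 1 x) hr0).trans
    (Real.rpow_le_rpow_of_exponent_le (le_max_left _ _) hra)

open Complex.HadamardThreeLines in
lemma riesz_thorin {ι : Type*} (S R : Finset ι) (a : ι → ι → ℂ) (A₁ A₂ p q : ℝ)
    (hp1 : 1 < p) (hp2 : p ≤ 2) (hq : 1 / p + 1 / q = 1) (hA₁ : 0 ≤ A₁) (hA₂ : 0 ≤ A₂)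
    (h1 : ∀ f g : ι → ℂ, (∀ x, ‖g x‖ ≤ 1) →
      ‖∑ x ∈ S, ∑ y ∈ R, a x y * f y * g x‖ ≤ A₁ * ∑ y ∈ R, ‖f y‖)
    (h2 : ∀ f g : ι → ℂ,
      ‖∑ x ∈ S, ∑ y ∈ R, a x y * f y * g x‖ ≤
        A₂ * ((∑ y ∈ R, ‖f y‖ ^ 2) ^ (1 / 2 : ℝ) * (∑ x ∈ S, ‖g x‖ ^ 2) ^ (1 / 2 : ℝ)))
    (f g : ι → ℂ) :
    ‖∑ x ∈ S, ∑ y ∈ R, a x y * f y * g x‖ ≤ A₁ ^ (1 - 2 / q) * A₂ ^ (2 / q) *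
      ((∑ y ∈ R, ‖f y‖ ^ p) ^ (1 / p) * (∑ x ∈ S, ‖g x‖ ^ q) ^ (1 / q)) := by
  have hp0 : 0 < p := by linarith
  have hq' : 1 / q = 1 - 1 / p := by linarith
  have hpinv : 1 / 2 ≤ 1 / p := one_div_le_one_div_of_le hp0 hp2
  have hpinv' : 1 / p < 1 := by rw [div_lt_one hp0]; exact hp1
  have hq0 : 0 < q := by
    have : 0 < 1 / q := by linarith
    exact one_div_pos.mp this
  have hθ0 : 0 < 2 / q := by positivity
  have hθ1 : 2 / q ≤ 1 := by
    have : 2 / q = 2 * (1 / q) := by ring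
    linarith
  set Φ : ℂ → ℂ := fun z => ∑ x ∈ S, ∑ y ∈ R,
    a x y * anF (f y) (p * (1 - z / 2)) * anF (g x) (q * z / 2) with hΦ
  have hre1 : ∀ z : ℂ, ((p : ℂ) * (1 - z / 2)).re = p * (1 - z.re / 2) := by
    intro z; simp
  have hre2 : ∀ z : ℂ, ((q : ℂ) * z / 2).re = q * z.re / 2 := by
    intro z; simp
  have hdiff : Differentiable ℂ Φ := by
    refine Differentiable.fun_sum fun x _ => Differentiable.fun_sum fun y _ => ?_
    refine Differentiable.mul (Differentiable.const_mul (anF_diff _ _ ?_) _) (anF_diff _ _ ?_) <;>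
      fun_prop
  have hbdd : BddAbove ((norm ∘ Φ) '' verticalClosedStrip 0 1) := by
    refine ⟨∑ x ∈ S, ∑ y ∈ R, ‖a x y‖ * max 1 ‖f y‖ ^ p * max 1 ‖g x‖ ^ (q / 2), ?_⟩
    rintro _ ⟨z, hz, rfl⟩
    have hz0 : 0 ≤ z.re := hz.1
    have hz1 : z.re ≤ 1 := hz.2
    refine norm_sum_le_of_le _ fun x _ => norm_sum_le_of_le _ fun y _ => ?_
    rw [norm_mul, norm_mul]
    have b1 : ‖anF (f y) (p * (1 - z / 2))‖ ≤ max 1 ‖f y‖ ^ p := by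
      refine (anF_norm_le _ _).trans ?_
      rw [hre1]
      exact rpow_le_max _ _ _ (norm_nonneg _) (by nlinarith) (by nlinarith)
    have b2 : ‖anF (g x) (q * z / 2)‖ ≤ max 1 ‖g x‖ ^ (q / 2) := by
      refine (anF_norm_le _ _).trans ?_
      rw [hre2]
      exact rpow_le_max _ _ _ (norm_nonneg _) (by positivity) (by nlinarith)
    gcongr
  set P := ∑ y ∈ R, ‖f y‖ ^ p with hP
  set Q := ∑ x ∈ S, ‖g x‖ ^ q with hQ
  have hP0 : 0 ≤ P := Finset.sum_nonneg fun _ _ => by positivity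
  have hQ0 : 0 ≤ Q := Finset.sum_nonneg fun _ _ => by positivity
  have key := norm_le_interp_of_mem_verticalClosedStrip₀₁' Φ (z := ((2 / q : ℝ) : ℂ))
    (a := A₁ * P) (b := A₂ * (P ^ (1 / 2 : ℝ) * Q ^ (1 / 2 : ℝ)))
    ⟨by simpa using hθ0.le, by simpa using hθ1⟩ hdiff.diffContOnCl hbdd
    (by
      intro z hz
      have hz : z.re = 0 := hz
      refine (h1 (fun y => anF (f y) (p * (1 - z / 2))) (fun x => anF (g x) (q * z / 2)) ?_).trans ?_
      · intro x
        refine (anF_norm_le _ _).trans ?_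
        rw [hre2, hz]; simp
      · refine mul_le_mul_of_nonneg_left (Finset.sum_le_sum fun y _ => ?_) hA₁
        refine (anF_norm_le _ _).trans ?_
        rw [hre1, hz]; simp)
    (by
      intro z hz
      have hz : z.re = 1 := hz
      refine (h2 (fun y => anF (f y) (p * (1 - z / 2))) (fun x => anF (g x) (q * z / 2))).trans ?_
      gcongr
      · refine Finset.sum_le_sum fun y _ => ?_
        rw [anF_norm _ _ (by rw [hre1, hz]; norm_num; exact hp0.ne'), hre1, hz,
          ← Real.rpow_natCast, ← Real.rpow_mul (norm_nonneg _)]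
        apply le_of_eq; congr 1; push_cast; ring
      · refine Finset.sum_le_sum fun x _ => ?_
        rw [anF_norm _ _ (by rw [hre2, hz]; norm_num; exact hq0.ne'), hre2, hz,
          ← Real.rpow_natCast, ← Real.rpow_mul (norm_nonneg _)]
        apply le_of_eq; congr 1; push_cast; ring)
  have hval : Φ ((2 / q : ℝ) : ℂ) = ∑ x ∈ S, ∑ y ∈ R, a x y * f y * g x := by
    have t1 : (p : ℂ) * (1 - ((2 / q : ℝ) : ℂ) / 2) = 1 := by
      have : p * (1 - (2 / q) / 2) = 1 := by
        have : (2 / q) / 2 = 1 / q := by ring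
        rw [this, hq']; field_simp; ring
      exact_mod_cast this
    have t2 : (q : ℂ) * ((2 / q : ℝ) : ℂ) / 2 = 1 := by
      have : q * (2 / q) / 2 = 1 := by field_simp
      exact_mod_cast this
    simp only [hΦ, t1, t2, anF_one]
  rw [hval, Complex.ofReal_re] at key
  refine key.trans (le_of_eq ?_)
  rw [Real.mul_rpow hA₁ hP0, Real.mul_rpow hA₂ (by positivity),
    Real.mul_rpow (by positivity) (by positivity), ← Real.rpow_mul hP0, ← Real.rpow_mul hQ0]
  have e1 : P ^ (1 / p) = P ^ (1 - 2 / q) * P ^ (1 / 2 * (2 / q)) := by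
    rw [← Real.rpow_add_of_nonneg hP0 (by linarith) (by positivity)]
    congr 1
    have : 2 / q = 2 * (1 / q) := by ring
    rw [this, hq']; ring
  have e2 : 1 / 2 * (2 / q) = 1 / q := by ring
  rw [e1, e2]; ring

attribute [local instance] instMeasureSpaceUnitAddCircle
attribute [local instance] instIsAddHaarMeasureUnitAddCircleVolume
attribute [local instance] instIsProbabilityMeasureUnitAddCircleVolume

open UnitAddTorus MeasureTheory in
lemma parseval_sum {ι : Type} [Fintype ι] (a : (ι → ℤ) → ℂ) (F : C(UnitAddTorus ι, ℂ))
    (h : HasSum (fun n => a n • mFourier n) F) :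
    HasSum (fun n => ‖a n‖ ^ 2) (∫ t, ‖F t‖ ^ 2) := by
  classical
  have h' : HasSum (fun n => a n • mFourierLp (d := ι) 2 n) (F.toLp 2 volume ℂ) := by
    have := h.mapL (ContinuousMap.toLp (E := ℂ) 2 (volume : Measure (UnitAddTorus ι)) ℂ)
    simpa using this
  have hc : ∀ m, mFourierCoeff F m = a m := by
    intro m
    rw [← mFourierCoeff_toLp, ← mFourierBasis_repr]
    have h2 := (h'.mapL (mFourierBasis (d := ι)).repr.toContinuousLinearEquiv.toContinuousLinearMap).mapL
      (lp.evalCLM ℂ (fun _ : ι → ℤ => ℂ) 2 m)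
    refine h2.unique ?_
    have ev : ∀ n, (lp.evalCLM ℂ (fun _ : ι → ℤ => ℂ) 2 m)
      ((mFourierBasis (d := ι)).repr.toContinuousLinearEquiv.toContinuousLinearMap
        (a n • mFourierLp (d := ι) 2 n)) = if n = m then a n else 0 := by
      intro n
      change (mFourierBasis.repr (a n • mFourierLp 2 n)) m = _
      have hb : mFourierLp (d := ι) 2 n = mFourierBasis n := by rw [coe_mFourierBasis]
      rw [hb, map_smul, HilbertBasis.repr_self, lp.coeFn_smul, Pi.smul_apply, lp.single_apply,
        smul_eq_mul]
      by_cases hnm : n = m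
      · subst hnm; simp
      · simp [hnm, Ne.symm hnm]
    simp only [ev]
    exact hasSum_ite_eq m (a m) |>.congr_fun (by intro n; by_cases hnm : n = m <;> simp [hnm])
  have := hasSum_sq_mFourierCoeff (F.toLp 2 volume ℂ)
  simp only [mFourierCoeff_toLp, hc] at this
  convert this using 1
  refine integral_congr_ae ?_
  filter_upwards [F.coeFn_toLp (p := 2) (𝕜 := ℂ) volume] with t ht
  rw [ht]

open UnitAddTorus MeasureTheory in
lemma plancherel_conv {ι : Type} [Fintype ι] (k : (ι → ℤ) → ℂ) (hk : Summable fun n => ‖k n‖)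
    (M : ℝ) (hM : ∀ ξ : ι → ℝ, ‖∑' n : ι → ℤ, k n *
      Complex.exp (2 * (π : ℂ) * Complex.I * ∑ j, (n j : ℂ) * (ξ j : ℂ))‖ ≤ M)
    (S R : Finset (ι → ℤ)) (f : (ι → ℤ) → ℂ) :
    ∑ x ∈ S, ‖∑ y ∈ R, k (x - y) * f y‖ ^ 2 ≤ M ^ 2 * ∑ y ∈ R, ‖f y‖ ^ 2 := by
  classical
  have hs : Summable (fun n => k n • mFourier n) := by
    refine Summable.of_norm ?_
    simpa [norm_smul, mFourier_norm] using hk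
  obtain ⟨F, hF⟩ := hs
  have hFb : ∀ t, ‖F t‖ ≤ M := by
    intro t
    choose ξ hξ using fun i => QuotientAddGroup.mk_surjective (t i)
    have h1 : HasSum (fun n => (k n • mFourier n) t) (F t) :=
      hF.mapL (ContinuousMap.evalCLM ℂ t)
    rw [← h1.tsum_eq]
    convert hM ξ using 4 with n
    simp only [ContinuousMap.smul_apply, smul_eq_mul, mFourier, ContinuousMap.coe_mk]
    congr 1
    rw [Finset.mul_sum, Complex.exp_sum]
    refine Finset.prod_congr rfl fun i _ => ?_
    rw [← hξ i]
    erw [fourier_coe_apply]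
    congr 1
    push_cast
    ring
  set P : C(UnitAddTorus ι, ℂ) := ∑ y ∈ R, f y • mFourier y with hP
  have hG : HasSum (fun n => (∑ y ∈ R, k (n - y) * f y) • mFourier n) (F * P) := by
    rw [hP, Finset.mul_sum]
    have e0 : ∀ n, (∑ y ∈ R, k (n - y) * f y) • mFourier n = ∑ y ∈ R, (k (n - y) * f y) • mFourier n :=
      fun n => by ext t; simp [Finset.sum_mul]
    simp only [e0]
    refine hasSum_sum fun y _ => ?_
    have := hF.mul_right (f y • mFourier y)
    rw [← (Equiv.subRight y).hasSum_iff] at this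
    refine HasSum.congr_fun this fun n => ?_
    ext t
    have : mFourier n t = mFourier (n - y) t * mFourier y t := by
      rw [← mFourier_add, sub_add_cancel]
    simp [this]
    ring
  have hPs : HasSum (fun n => (if n ∈ R then f n else 0) • mFourier n) P := by
    have := hasSum_sum_of_ne_finset_zero (L := SummationFilter.unconditional _) (f := fun n => (if n ∈ R then f n else 0) • mFourier (d := ι) n) (s := R)
      (by intro b hb; ext t; simp [hb])
    convert this using 1
    rw [hP]
    exact Finset.sum_congr rfl fun y hy => by simp [hy]
  have e1 := parseval_sum _ _ hG
  have e2 := parseval_sum _ _ hPs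
  have e3 : ∑ y ∈ R, ‖f y‖ ^ 2 = ∫ t, ‖P t‖ ^ 2 := by
    rw [← e2.tsum_eq, tsum_eq_sum (s := R) (by intro b hb; simp [hb])]
    exact Finset.sum_congr rfl fun y hy => by simp [hy]
  rw [e3, ← integral_const_mul]
  refine (sum_le_hasSum S (fun _ _ => by positivity) e1).trans ?_
  refine integral_mono ?_ ?_ ?_
  · exact Continuous.integrable_of_hasCompactSupport (by fun_prop) (HasCompactSupport.of_compactSpace _)
  · exact Continuous.integrable_of_hasCompactSupport (by fun_prop) (HasCompactSupport.of_compactSpace _)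
  · intro t
    simp only [ContinuousMap.mul_apply, norm_mul, mul_pow]
    have := hFb t
    gcongr

/-! ### convolution on lp -/

lemma norm_char {d : ℕ} (ξ : Fin d → ℝ) (n : Fin d → ℤ) :
    ‖Complex.exp (2 * (π : ℂ) * Complex.I * ∑ j, (n j : ℂ) * (ξ j : ℂ))‖ = 1 := by
  have : 2 * (π : ℂ) * Complex.I * ∑ j, (n j : ℂ) * (ξ j : ℂ)
      = ((2 * π * ∑ j, (n j : ℝ) * ξ j : ℝ) : ℂ) * Complex.I := by push_cast; ring
  rw [this, Complex.norm_exp_ofReal_mul_I]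

lemma hat_le {d : ℕ} (k : (Fin d → ℤ) → ℂ) (hk : Summable fun n => ‖k n‖) (ξ : Fin d → ℝ) :
    ‖∑' n : Fin d → ℤ, k n *
      Complex.exp (2 * (π : ℂ) * Complex.I * ∑ j, (n j : ℂ) * (ξ j : ℂ))‖ ≤ ∑' n : Fin d → ℤ, ‖k n‖ := by
  have hn := norm_char (d := d) ξ
  have hs : Summable fun n : Fin d → ℤ => ‖k n *
      Complex.exp (2 * (π : ℂ) * Complex.I * ∑ j, (n j : ℂ) * (ξ j : ℂ))‖ := by
    simpa only [norm_mul, hn, mul_one] using hk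
  have h := norm_tsum_le_tsum_norm hs
  simp only [norm_mul, hn, mul_one] at h
  exact h

lemma lp_conv_fin {d : ℕ} (p q : ℝ) (hp1 : 1 < p) (hp2 : p ≤ 2) (hq : 1 / p + 1 / q = 1)
    (k : (Fin d → ℤ) → ℂ) (hk : Summable fun n => ‖k n‖)
    (A M : ℝ) (hA : ∑' n, ‖k n‖ ≤ A) (hM : ∀ ξ : Fin d → ℝ, ‖∑' n : Fin d → ℤ, k n *
      Complex.exp (2 * (π : ℂ) * Complex.I * ∑ j, (n j : ℂ) * (ξ j : ℂ))‖ ≤ M)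
    (S R : Finset (Fin d → ℤ)) (f : (Fin d → ℤ) → ℂ) :
    ∑ x ∈ S, ‖∑ y ∈ R, k (x - y) * f y‖ ^ p ≤
      (A ^ (1 - 2 / q) * M ^ (2 / q)) ^ p * ∑ y ∈ R, ‖f y‖ ^ p := by
  have hp0 : 0 < p := by linarith
  have hq' : 1 / q = 1 - 1 / p := by linarith
  have hpinv' : 1 / p < 1 := by rw [div_lt_one hp0]; exact hp1
  have hq0 : 0 < q := by
    have : 0 < 1 / q := by linarith
    exact one_div_pos.mp this
  have hA0 : 0 ≤ A := le_trans (tsum_nonneg fun _ => norm_nonneg _) hA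
  have hM0 : 0 ≤ M := (norm_nonneg _).trans (hM 0)
  have h1 : ∀ f g : (Fin d → ℤ) → ℂ, (∀ x, ‖g x‖ ≤ 1) →
      ‖∑ x ∈ S, ∑ y ∈ R, k (x - y) * f y * g x‖ ≤ A * ∑ y ∈ R, ‖f y‖ := by
    intro f g hg
    rw [Finset.sum_comm, Finset.mul_sum]
    refine norm_sum_le_of_le _ fun y _ => ?_
    calc ‖∑ x ∈ S, k (x - y) * f y * g x‖ ≤ ∑ x ∈ S, ‖k (x - y)‖ * ‖f y‖ := by
          refine norm_sum_le_of_le _ fun x _ => ?_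
          rw [norm_mul, norm_mul]
          exact mul_le_of_le_one_right (by positivity) (hg x)
      _ = (∑ x ∈ S, ‖k (x - y)‖) * ‖f y‖ := by rw [Finset.sum_mul]
      _ ≤ A * ‖f y‖ := by
          gcongr
          refine le_trans ?_ hA
          have e := (Equiv.subRight y).summable_iff (f := fun n => ‖k n‖) |>.mpr hk
          refine (e.sum_le_tsum S (fun _ _ => norm_nonneg _)).trans (le_of_eq ?_)
          exact (Equiv.subRight y).tsum_eq (fun n => ‖k n‖)
  have h2 : ∀ f g : (Fin d → ℤ) → ℂ,
      ‖∑ x ∈ S, ∑ y ∈ R, k (x - y) * f y * g x‖ ≤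
        M * ((∑ y ∈ R, ‖f y‖ ^ 2) ^ (1 / 2 : ℝ) * (∑ x ∈ S, ‖g x‖ ^ 2) ^ (1 / 2 : ℝ)) := by
    intro f g
    have pl := plancherel_conv k hk M hM S R f
    simp_rw [← Finset.sum_mul, ← Real.sqrt_eq_rpow]
    calc ‖∑ x ∈ S, (∑ y ∈ R, k (x - y) * f y) * g x‖
        ≤ ∑ x ∈ S, ‖∑ y ∈ R, k (x - y) * f y‖ * ‖g x‖ :=
          norm_sum_le_of_le _ fun x _ => (norm_mul _ _).le
      _ ≤ √(∑ x ∈ S, ‖∑ y ∈ R, k (x - y) * f y‖ ^ 2) * √(∑ x ∈ S, ‖g x‖ ^ 2) :=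
          Real.sum_mul_le_sqrt_mul_sqrt _ _ _
      _ ≤ √(M ^ 2 * ∑ y ∈ R, ‖f y‖ ^ 2) * √(∑ x ∈ S, ‖g x‖ ^ 2) := by gcongr
      _ = _ := by rw [Real.sqrt_mul (by positivity), Real.sqrt_sq hM0]; ring
  set G : (Fin d → ℤ) → ℂ := fun x => ∑ y ∈ R, k (x - y) * f y with hG
  have rt := riesz_thorin S R (fun x y => k (x - y)) A M p q hp1 hp2 hq hA0 hM0 h1 h2 f
    (fun x => starRingEnd ℂ (anF (G x) ((p - 1 : ℝ) : ℂ)))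
  have hp10 : 0 < p - 1 := by linarith
  have hpq : (p - 1) * q = p := by
    have : q = p / (p - 1) := by
      field_simp at hq
      field_simp
      linarith
    rw [this]; field_simp
  have hn : ∀ x, ‖starRingEnd ℂ (anF (G x) ((p - 1 : ℝ) : ℂ))‖ ^ q = ‖G x‖ ^ p := by
    intro x
    rw [RCLike.norm_conj, anF_norm _ _ (by simpa using hp10.ne'), Complex.ofReal_re,
      ← Real.rpow_mul (norm_nonneg _), hpq]
  have hm : ∀ x, G x * starRingEnd ℂ (anF (G x) ((p - 1 : ℝ) : ℂ)) = ((‖G x‖ ^ p : ℝ) : ℂ) := by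
    intro x
    unfold anF
    split_ifs with h
    · simp [h, hp0.ne']
    · have hpos : 0 < ‖G x‖ := by simpa using h
      rw [← Complex.ofReal_cpow hpos.le, map_mul, map_div₀, Complex.conj_ofReal, Complex.conj_ofReal]
      have e1 : G x * (starRingEnd ℂ (G x) / (‖G x‖ : ℂ) * ((‖G x‖ ^ (p - 1) : ℝ) : ℂ))
        = (G x * starRingEnd ℂ (G x)) / (‖G x‖ : ℂ) * ((‖G x‖ ^ (p - 1) : ℝ) : ℂ) := by ring
      rw [e1, Complex.mul_conj, Complex.normSq_eq_norm_sq]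
      norm_cast
      rw [Real.rpow_sub hpos, Real.rpow_one]
      field_simp
  simp_rw [← Finset.sum_mul] at rt
  simp only [hn] at rt
  have hl : ∑ x ∈ S, (∑ y ∈ R, k (x - y) * f y) * starRingEnd ℂ (anF (G x) ((p - 1 : ℝ) : ℂ))
      = ((∑ x ∈ S, ‖G x‖ ^ p : ℝ) : ℂ) := by
    rw [Complex.ofReal_sum]
    exact Finset.sum_congr rfl fun x _ => hm x
  rw [hl] at rt
  have hW0 : 0 ≤ ∑ x ∈ S, ‖G x‖ ^ p := Finset.sum_nonneg fun _ _ => by positivity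
  have hP0 : 0 ≤ ∑ y ∈ R, ‖f y‖ ^ p := Finset.sum_nonneg fun _ _ => by positivity
  rw [Complex.norm_of_nonneg hW0] at rt
  set W := ∑ x ∈ S, ‖G x‖ ^ p with hW
  set P := ∑ y ∈ R, ‖f y‖ ^ p with hP
  set Cc := A ^ (1 - 2 / q) * M ^ (2 / q) with hCc
  have hC0 : 0 ≤ Cc := by positivity
  change W ≤ _
  rcases hW0.eq_or_lt with h0 | hpos
  · rw [← h0]; positivity
  · have e1 : W ^ (1 / p) ≤ Cc * P ^ (1 / p) := by
      have hw : W = W ^ (1 / p) * W ^ (1 / q) := by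
        rw [← Real.rpow_add hpos, hq, Real.rpow_one]
      have hwq : 0 < W ^ (1 / q) := by positivity
      refine le_of_mul_le_mul_right ?_ hwq
      rw [← hw]
      linarith
    have e2 := Real.rpow_le_rpow (by positivity) e1 hp0.le
    rw [Real.mul_rpow hC0 (by positivity), ← Real.rpow_mul hW0, ← Real.rpow_mul hP0,
      one_div_mul_cancel hp0.ne', Real.rpow_one, Real.rpow_one] at e2
    exact e2

/-- the ℓ^p space -/
abbrev El (d : ℕ) (p : ℝ) : Type := lp (fun _ : Fin d → ℤ => ℂ) (ENNReal.ofReal p)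

lemma El_summable {d : ℕ} {p : ℝ} (hp : 1 < p) (f : El d p) : Summable fun x => ‖f x‖ ^ p := by
  have h0 : 0 < (ENNReal.ofReal p).toReal := by
    rw [ENNReal.toReal_ofReal (by linarith)]; linarith
  have := (lp.memℓp f).summable h0
  rwa [ENNReal.toReal_ofReal (by linarith)] at this

lemma El_norm {d : ℕ} {p : ℝ} (hp : 1 < p) (f : El d p) : ‖f‖ ^ p = ∑' x, ‖f x‖ ^ p := by
  have h0 : 0 < (ENNReal.ofReal p).toReal := by
    rw [ENNReal.toReal_ofReal (by linarith)]; linarith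
  have := lp.norm_rpow_eq_tsum h0 f
  rwa [ENNReal.toReal_ofReal (by linarith)] at this

lemma conv_summable {d : ℕ} {p : ℝ} (hp : 1 < p)
    (k : (Fin d → ℤ) → ℂ) (hk : Summable fun n => ‖k n‖) (f : El d p) (x : Fin d → ℤ) :
    Summable fun y => k y * f (x - y) := by
  refine Summable.of_norm_bounded (hk.mul_right ‖f‖) fun y => ?_
  rw [norm_mul]
  gcongr
  exact lp.norm_apply_le_norm (by simp; linarith) f _

lemma lp_conv_sum {d : ℕ} (p q : ℝ) (hp1 : 1 < p) (hp2 : p ≤ 2) (hq : 1 / p + 1 / q = 1)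
    (k : (Fin d → ℤ) → ℂ) (hk : Summable fun n => ‖k n‖)
    (A M : ℝ) (hA : ∑' n, ‖k n‖ ≤ A) (hM : ∀ ξ : Fin d → ℝ, ‖∑' n : Fin d → ℤ, k n *
      Complex.exp (2 * (π : ℂ) * Complex.I * ∑ j, (n j : ℂ) * (ξ j : ℂ))‖ ≤ M)
    (S : Finset (Fin d → ℤ)) (f : El d p) :
    ∑ x ∈ S, ‖∑' y, k y * f (x - y)‖ ^ p ≤ (A ^ (1 - 2 / q) * M ^ (2 / q) * ‖f‖) ^ p := by
  have hA0 : 0 ≤ A := le_trans (tsum_nonneg fun _ => norm_nonneg _) hA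
  have hM0 : 0 ≤ M := (norm_nonneg _).trans (hM 0)
  have lim : Filter.Tendsto (fun R : Finset (Fin d → ℤ) =>
      ∑ x ∈ S, ‖∑ y ∈ R, k (x - y) * f y‖ ^ p) Filter.atTop
      (nhds (∑ x ∈ S, ‖∑' y, k y * f (x - y)‖ ^ p)) := by
    refine tendsto_finsetSum _ fun x _ => ?_
    have h1 : HasSum (fun y => k (x - y) * f y) (∑' y, k y * f (x - y)) := by
      have := (conv_summable hp1 k hk f x).hasSum
      rw [← (Equiv.subLeft x).hasSum_iff] at this
      refine HasSum.congr_fun this fun y => ?_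
      simp
    exact (h1.norm).rpow_const (Or.inr (by linarith))
  refine le_of_tendsto' lim fun R => ?_
  refine (lp_conv_fin p q hp1 hp2 hq k hk A M hA hM S R f).trans ?_
  rw [Real.mul_rpow (mul_nonneg (Real.rpow_nonneg hA0 _) (Real.rpow_nonneg hM0 _)) (lp.norm_nonneg' f),
    El_norm hp1]
  gcongr
  exact (El_summable hp1 f).sum_le_tsum R (fun _ _ => by positivity)

lemma conv_mem {d : ℕ} (p q : ℝ) (hp1 : 1 < p) (hp2 : p ≤ 2) (hq : 1 / p + 1 / q = 1)
    (k : (Fin d → ℤ) → ℂ) (hk : Summable fun n => ‖k n‖) (f : El d p) :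
    Memℓp (E := fun _ : Fin d → ℤ => ℂ) (fun x => ∑' y, k y * f (x - y)) (ENNReal.ofReal p) := by
  refine memℓp_gen' (C := ((∑' n, ‖k n‖) ^ (1 - 2 / q) * (∑' n, ‖k n‖) ^ (2 / q) * ‖f‖) ^ p) ?_
  intro S
  rw [ENNReal.toReal_ofReal (by linarith)]
  exact lp_conv_sum p q hp1 hp2 hq k hk _ _ le_rfl (hat_le k hk) S f

open Classical in
/-- convolution as an ℓ^p element -/
noncomputable def cv {d : ℕ} {p : ℝ} (k : (Fin d → ℤ) → ℂ) (f : El d p) : El d p :=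
  if h : Memℓp (E := fun _ : Fin d → ℤ => ℂ) (fun x => ∑' y, k y * f (x - y)) (ENNReal.ofReal p)
  then ⟨_, h⟩ else 0

lemma cv_apply {d : ℕ} (p q : ℝ) (hp1 : 1 < p) (hp2 : p ≤ 2) (hq : 1 / p + 1 / q = 1)
    (k : (Fin d → ℤ) → ℂ) (hk : Summable fun n => ‖k n‖) (f : El d p) (x : Fin d → ℤ) :
    cv k f x = ∑' y, k y * f (x - y) := by
  unfold cv
  rw [dif_pos (conv_mem p q hp1 hp2 hq k hk f)]

lemma cv_sub {d : ℕ} (p q : ℝ) (hp1 : 1 < p) (hp2 : p ≤ 2) (hq : 1 / p + 1 / q = 1)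
    (k l : (Fin d → ℤ) → ℂ) (hk : Summable fun n => ‖k n‖) (hl : Summable fun n => ‖l n‖)
    (hkl : Summable fun n => ‖(k - l) n‖) (f : El d p) :
    cv (k - l) f = cv k f - cv l f := by
  refine lp.ext (funext fun x => ?_)
  rw [lp.coeFn_sub, Pi.sub_apply, cv_apply p q hp1 hp2 hq k hk, cv_apply p q hp1 hp2 hq l hl,
    cv_apply p q hp1 hp2 hq _ hkl,
    ← (conv_summable hp1 k hk f x).tsum_sub (conv_summable hp1 l hl f x)]
  exact tsum_congr fun y => by simp [sub_mul]

lemma cv_norm {d : ℕ} (p q : ℝ) (hp1 : 1 < p) (hp2 : p ≤ 2) (hq : 1 / p + 1 / q = 1)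
    (k : (Fin d → ℤ) → ℂ) (hk : Summable fun n => ‖k n‖)
    (A M : ℝ) (hA : ∑' n, ‖k n‖ ≤ A) (hM : ∀ ξ : Fin d → ℝ, ‖∑' n : Fin d → ℤ, k n *
      Complex.exp (2 * (π : ℂ) * Complex.I * ∑ j, (n j : ℂ) * (ξ j : ℂ))‖ ≤ M) (f : El d p) :
    ‖cv k f‖ ≤ A ^ (1 - 2 / q) * M ^ (2 / q) * ‖f‖ := by
  have hA0 : 0 ≤ A := le_trans (tsum_nonneg fun _ => norm_nonneg _) hA
  have hM0 : 0 ≤ M := (norm_nonneg _).trans (hM 0)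
  refine lp.norm_le_of_forall_sum_le ?_ (mul_nonneg (mul_nonneg (Real.rpow_nonneg hA0 _)
    (Real.rpow_nonneg hM0 _)) (lp.norm_nonneg' f)) ?_
  · rw [ENNReal.toReal_ofReal (by linarith)]; linarith
  · intro S
    rw [ENNReal.toReal_ofReal (by linarith)]
    simp_rw [cv_apply p q hp1 hp2 hq k hk f]
    exact lp_conv_sum p q hp1 hp2 hq k hk A M hA hM S f

lemma lpNorm_El {d : ℕ} {p : ℝ} (hp : 1 < p) (f : El d p) :
    lpNorm d p (fun x => (‖f x‖₊ : ℝ≥0∞)) = ENNReal.ofReal ‖f‖ := by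
  have hp0 : 0 < p := by linarith
  unfold lpNorm
  have e : ∀ x, (‖f x‖₊ : ℝ≥0∞) ^ p = ENNReal.ofReal (‖f x‖ ^ p) := by
    intro x
    rw [← ENNReal.ofReal_rpow_of_nonneg (norm_nonneg _) hp0.le, ofReal_norm]
    rfl
  simp_rw [e]
  rw [← ENNReal.ofReal_tsum_of_nonneg (fun x => by positivity) (El_summable hp f), ← El_norm hp,
    ENNReal.ofReal_rpow_of_nonneg (Real.rpow_nonneg (lp.norm_nonneg' f) _) (by positivity),
    ← Real.rpow_mul (lp.norm_nonneg' f),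
    mul_one_div_cancel hp0.ne', Real.rpow_one]

lemma mem_of_lpNorm {d : ℕ} {p : ℝ} (hp : 1 < p) (f : (Fin d → ℤ) → ℂ)
    (hf : lpNorm d p (fun x => (‖f x‖₊ : ℝ≥0∞)) < ⊤) :
    Memℓp (E := fun _ : Fin d → ℤ => ℂ) f (ENNReal.ofReal p) := by
  have hp0 : 0 < p := by linarith
  refine memℓp_gen ?_
  rw [ENNReal.toReal_ofReal hp0.le]
  unfold lpNorm at hf
  have h1 : ∑' x, (‖f x‖₊ : ℝ≥0∞) ^ p ≠ ⊤ := by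
    intro h
    rw [h, ENNReal.top_rpow_of_pos (by positivity)] at hf
    exact lt_irrefl _ hf
  have e : ∀ x, (‖f x‖₊ : ℝ≥0∞) ^ p = ((‖f x‖₊ ^ p : NNReal) : ℝ≥0∞) := by
    intro x
    rw [ENNReal.coe_rpow_of_nonneg _ hp0.le]
  simp_rw [e] at h1
  have := ENNReal.tsum_coe_ne_top_iff_summable.mp h1
  rw [← NNReal.summable_coe] at this
  simpa using this

lemma fd_kernel {d : ℕ} (K : ℝ → (Fin d → ℤ) → ℂ) (B h : ℝ) (hh : 0 < h)
    (hs : ∀ t : ℝ, 0 < t → Summable fun k : Fin d → ℤ => ‖K t k‖)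
    (hB : ∀ t : ℝ, 0 < t → (∑' k : Fin d → ℤ, ‖K t k‖) ≤ B) (j : ℕ) :
    ∀ s, 0 < s → Summable (fun k => ‖(fwdDiff h)^[j] K s k‖) ∧
      ∑' k, ‖(fwdDiff h)^[j] K s k‖ ≤ 2 ^ j * B := by
  induction j with
  | zero => intro s hs0; simpa using ⟨hs s hs0, hB s hs0⟩
  | succ j ih =>
    intro s hs0
    obtain ⟨a1, b1⟩ := ih (s + h) (by linarith)
    obtain ⟨a2, b2⟩ := ih s hs0
    rw [Function.iterate_succ_apply']
    have le : ∀ k, ‖fwdDiff h ((fwdDiff h)^[j] K) s k‖ ≤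
      ‖(fwdDiff h)^[j] K (s + h) k‖ + ‖(fwdDiff h)^[j] K s k‖ := fun k => norm_sub_le _ _
    have hsum := Summable.of_nonneg_of_le (fun k => norm_nonneg _) le (a1.add a2)
    refine ⟨hsum, (hsum.tsum_le_tsum le (a1.add a2)).trans ?_⟩
    rw [a1.tsum_add a2, pow_succ]
    linarith

lemma char_summable {d : ℕ} (k : (Fin d → ℤ) → ℂ) (hk : Summable fun n => ‖k n‖) (ξ : Fin d → ℝ) :
    Summable fun n : Fin d → ℤ => k n *
      Complex.exp (2 * (π : ℂ) * Complex.I * ∑ j, (n j : ℂ) * (ξ j : ℂ)) := by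
  refine Summable.of_norm ?_
  simpa only [norm_mul, norm_char, mul_one] using hk

lemma fd_mult {d : ℕ} (K : ℝ → (Fin d → ℤ) → ℂ) (B h : ℝ) (hh : 0 < h)
    (hs : ∀ t : ℝ, 0 < t → Summable fun k : Fin d → ℤ => ‖K t k‖)
    (hB : ∀ t : ℝ, 0 < t → (∑' k : Fin d → ℤ, ‖K t k‖) ≤ B) (ξ : Fin d → ℝ) (j : ℕ) :
    ∀ s, 0 < s → mult d ((fwdDiff h)^[j] K) s ξ = (fwdDiff h)^[j] (fun u => mult d K u ξ) s := by
  induction j with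
  | zero => intro s _; rfl
  | succ j ih =>
    intro s hs0
    have a1 := (fd_kernel K B h hh hs hB j (s + h) (by linarith)).1
    have a2 := (fd_kernel K B h hh hs hB j s hs0).1
    rw [Function.iterate_succ_apply', Function.iterate_succ_apply', fwdDiff, ← ih _ (by linarith),
      ← ih s hs0]
    unfold mult
    rw [← (char_summable _ a1 ξ).tsum_sub (char_summable _ a2 ξ)]
    refine tsum_congr fun n => ?_
    rw [← sub_mul]
    rfl

lemma fd_cv {d : ℕ} (p q : ℝ) (hp1 : 1 < p) (hp2 : p ≤ 2) (hq : 1 / p + 1 / q = 1)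
    (K : ℝ → (Fin d → ℤ) → ℂ) (B h : ℝ) (hh : 0 < h)
    (hs : ∀ t : ℝ, 0 < t → Summable fun k : Fin d → ℤ => ‖K t k‖)
    (hB : ∀ t : ℝ, 0 < t → (∑' k : Fin d → ℤ, ‖K t k‖) ≤ B) (f : El d p) (j : ℕ) :
    ∀ s, 0 < s → (fwdDiff h)^[j] (fun u => cv (K u) f) s = cv ((fwdDiff h)^[j] K s) f := by
  induction j with
  | zero => intro s _; rfl
  | succ j ih =>
    intro s hs0
    have a1 := (fd_kernel K B h hh hs hB j (s + h) (by linarith)).1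
    have a2 := (fd_kernel K B h hh hs hB j s hs0).1
    have a3 := (fd_kernel K B h hh hs hB (j + 1) s hs0).1
    rw [Function.iterate_succ_apply'] at a3
    rw [Function.iterate_succ_apply', Function.iterate_succ_apply', fwdDiff, ih _ (by linarith),
      ih s hs0]
    exact (cv_sub p q hp1 hp2 hq _ _ a1 a2 a3 f).symm

/-- Dimension-free ℓ^p bound for differences of multiplier operators satisfying condition
`(B_n)`: if `K_t ∈ ℓ¹(ℤ^d)` with `‖K_t‖_{ℓ¹} ≤ B`, `t ↦ m_t(ξ)` is smooth on `(0,∞)`,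
`|s^j ∂_s^j m_s(ξ)| ≤ B` for `0 ≤ j ≤ n`, and `1 < p ≤ 2` with dual exponent `q` satisfies
`2n/q ≤ 1`, then for every `α ∈ (0, 2n/q)` there is `C(n,p,α) > 0` (independent of `d`, `B` and
the family `K`) with `‖(K_{t+w} - K_t) * f‖_{ℓ^p} ≤ C(n,p,α) B (w/t)^α ‖f‖_{ℓ^p}`. -/
theorem multiplier_difference_lp (n : ℕ) (hn : 0 < n) (p q : ℝ) (hp1 : 1 < p) (hp2 : p ≤ 2)
    (hq : 1 / p + 1 / q = 1) (hnq : 2 * n / q ≤ 1)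
    (α : ℝ) (hα0 : 0 < α) (hα : α < 2 * n / q) :
    ∃ C : ℝ, 0 < C ∧
      ∀ B : ℝ, 1 ≤ B → ∀ d : ℕ, 0 < d → ∀ K : ℝ → (Fin d → ℤ) → ℂ,
      (∀ t : ℝ, 0 < t → Summable fun k : Fin d → ℤ => ‖K t k‖) →
      (∀ t : ℝ, 0 < t → (∑' k : Fin d → ℤ, ‖K t k‖) ≤ B) →
      (∀ ξ : Fin d → ℝ, ContDiffOn ℝ (⊤ : ℕ∞) (fun t => mult d K t ξ) (Set.Ioi 0)) →
      (∀ j : ℕ, j ≤ n → ∀ s : ℝ, 0 < s → ∀ ξ : Fin d → ℝ,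
        ‖(s : ℂ) ^ j * iteratedDeriv j (fun u => mult d K u ξ) s‖ ≤ B) →
      ∀ w t : ℝ, 0 < w → 0 < t → ∀ f : (Fin d → ℤ) → ℂ,
        lpNorm d p (fun x => (‖f x‖₊ : ℝ≥0∞)) < ⊤ →
        lpNorm d p
            (fun x => (‖∑' y : Fin d → ℤ, (K (t + w) y - K t y) * f (x - y)‖₊ : ℝ≥0∞))
          ≤ ENNReal.ofReal (C * B * (w / t) ^ α) *
              lpNorm d p (fun x => (‖f x‖₊ : ℝ≥0∞)) := by
  obtain ⟨m, rfl⟩ : ∃ m, n = m + 1 := ⟨n - 1, by omega⟩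
  have hp0 : 0 < p := by linarith
  have hα1 : α < 1 := by linarith
  have hq' : 1 / q = 1 - 1 / p := by linarith
  have hpinv : 1 / 2 ≤ 1 / p := one_div_le_one_div_of_le hp0 hp2
  have hpinv' : 1 / p < 1 := by rw [div_lt_one hp0]; exact hp1
  have hq0 : 0 < q := by
    have : 0 < 1 / q := by linarith
    exact one_div_pos.mp this
  have hθ0 : 0 < 2 / q := by positivity
  have hθ1 : 2 / q ≤ 1 := by
    have : 2 / q = 2 * (1 / q) := by ring
    linarith
  obtain ⟨c, hc, H⟩ := marchaud m α hα1
  refine ⟨c * 2 ^ (m + 1) + 1, by positivity, ?_⟩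
  intro B hB1 d hd K hs hB hsm hder w t hw ht f₀ hf₀
  have : Fact (1 ≤ ENNReal.ofReal p) := ⟨by
    rw [← ENNReal.ofReal_one]; exact ENNReal.ofReal_le_ofReal hp1.le⟩
  have hB0 : 0 < B := by linarith
  set f : El d p := ⟨f₀, mem_of_lpNorm hp1 f₀ hf₀⟩ with hf
  have hff : ∀ x, f₀ x = f x := fun x => rfl
  have hcvb : ∀ s, t ≤ s → ‖cv (K s) f‖ ≤ B * ‖f‖ := by
    intro s hst
    have hs0 : 0 < s := by linarith
    have := cv_norm p q hp1 hp2 hq (K s) (hs s hs0) B B (hB s hs0)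
      (fun ξ => (hat_le (K s) (hs s hs0) ξ).trans (hB s hs0)) f
    rwa [← Real.rpow_add hB0, sub_add_cancel, Real.rpow_one] at this
  have main := H (El d p) (fun u => cv (K u) f) t (2 ^ (m + 1) * B * ‖f‖ * (t ^ α)⁻¹) (B * ‖f‖)
    (by positivity) (by positivity) hcvb ?_ w hw t le_rfl
  · have e1 : ∀ x, (∑' y : Fin d → ℤ, (K (t + w) y - K t y) * f₀ (x - y))
        = (cv (K (t + w)) f - cv (K t) f : El d p) x := by
      intro x
      rw [lp.coeFn_sub, Pi.sub_apply, cv_apply p q hp1 hp2 hq _ (hs _ (by linarith)),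
        cv_apply p q hp1 hp2 hq _ (hs t ht),
        ← (conv_summable hp1 _ (hs _ (by linarith)) f x).tsum_sub
          (conv_summable hp1 _ (hs t ht) f x)]
      exact tsum_congr fun y => by rw [← sub_mul]
    simp_rw [e1, hff]
    rw [lpNorm_El hp1, lpNorm_El hp1, ← ENNReal.ofReal_mul (by positivity)]
    refine ENNReal.ofReal_le_ofReal (main.trans ?_)
    rw [Real.div_rpow hw.le ht.le]
    have : 0 ≤ B * (w ^ α / t ^ α) * ‖f‖ := by positivity
    calc _ = c * 2 ^ (m + 1) * B * (w ^ α / t ^ α) * ‖f‖ := by ring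
      _ ≤ _ := by linarith
  · intro h hh s hst
    have hs0 : 0 < s := by linarith
    have e2 : 2 ^ (m + 1) * B * ‖f‖ * (t ^ α)⁻¹ * h ^ α = 2 ^ (m + 1) * B * (h / t) ^ α * ‖f‖ := by
      rw [Real.div_rpow hh.le ht.le]; ring
    rw [e2]
    have hr0 : 0 < h / t := by positivity
    rcases le_or_gt (h / t) 1 with hr | hr
    · rw [fd_cv p q hp1 hp2 hq K B h hh hs hB f _ s hs0]
      obtain ⟨a1, a2⟩ := fd_kernel K B h hh hs hB (m + 1) s hs0
      have := cv_norm p q hp1 hp2 hq _ a1 (2 ^ (m + 1) * B) (B * (h / t) ^ (m + 1)) a2 (by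
        intro ξ
        change ‖mult d ((fwdDiff h)^[m + 1] K) s ξ‖ ≤ _
        rw [fd_mult K B h hh hs hB ξ _ s hs0]
        refine (fd_smooth (m + 1) _ t (B / t ^ (m + 1)) ht (hsm ξ) ?_ h hh s hst).trans
          (le_of_eq ?_)
        · intro u hu
          have hu0 : 0 < u := by linarith
          have := hder (m + 1) le_rfl u hu0 ξ
          rw [norm_mul, norm_pow, Complex.norm_of_nonneg hu0.le] at this
          rw [le_div_iff₀ (by positivity), mul_comm]
          refine le_trans ?_ this
          gcongr
        · rw [div_pow]; ring) f
      refine this.trans (mul_le_mul_of_nonneg_right ?_ (norm_nonneg f))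
      rw [Real.mul_rpow (by positivity) hB0.le, Real.mul_rpow hB0.le (by positivity)]
      have e3 : B ^ (1 - 2 / q) * B ^ (2 / q) = B := by
        rw [← Real.rpow_add hB0, sub_add_cancel, Real.rpow_one]
      have e4 : ((2 : ℝ) ^ (m + 1)) ^ (1 - 2 / q) ≤ 2 ^ (m + 1) := by
        refine (Real.rpow_le_rpow_of_exponent_le (one_le_pow₀ (by norm_num))
          (show 1 - 2 / q ≤ 1 by linarith)).trans (by rw [Real.rpow_one])
      have e5 : ((h / t) ^ (m + 1)) ^ (2 / q) ≤ (h / t) ^ α := by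
        rw [← Real.rpow_natCast, ← Real.rpow_mul hr0.le]
        refine Real.rpow_le_rpow_of_exponent_ge hr0 hr ?_
        refine hα.le.trans (le_of_eq ?_)
        ring
      calc _ = ((2 : ℝ) ^ (m + 1)) ^ (1 - 2 / q) * (B ^ (1 - 2 / q) * B ^ (2 / q)) *
            ((h / t) ^ (m + 1)) ^ (2 / q) := by ring
        _ ≤ 2 ^ (m + 1) * B * (h / t) ^ α := by
          rw [e3]; gcongr
    · refine (fd_bound _ h t _ hh hcvb (m + 1) s hst).trans ?_
      have : 1 ≤ (h / t) ^ α := Real.one_le_rpow hr.le hα0.le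
      have h0 : 0 ≤ 2 ^ (m + 1) * B * ‖f‖ := by positivity
      nlinarith [mul_le_mul_of_nonneg_left this h0]
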